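/- Let I = (F_t)_{t∈[0,1]} be an identity isotopy on the 2-sphere S², and let z₁, z₂, z₃ be three pairwise distinct fixed points of the time-one map F₁. Then there exists an identity isotopy I' = (F'_t)_{t∈[0,1]} on S² with F'₀ = Id, F'₁ = F₁, and F'_t(z_i) = z_i for every t ∈ [0,1] and every i ∈ {1,2,3}. -/

import Mathlib

/-- The 2-sphere, realized as the unit sphere in `ℝ³`. -/
abbrev Sphere2 : Type := Metric.sphere (0 : EuclideanSpace ℝ (Fin 3)) 1

open Filter Topology

noncomputable section

namespace CR

abbrev E := EuclideanSpace ℝ (Fin 3)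

def J (a v : E) : E := !₂[a 1 * v 2 - a 2 * v 1, a 2 * v 0 - a 0 * v 2, a 0 * v 1 - a 1 * v 0]

lemma inner3 (u v : E) : inner ℝ u v = u 0 * v 0 + u 1 * v 1 + u 2 * v 2 := by
  simp [PiLp.inner_apply, Fin.sum_univ_three]; ring

lemma norm3 (u : E) : ‖u‖ ^ 2 = u 0 * u 0 + u 1 * u 1 + u 2 * u 2 := by
  rw [← real_inner_self_eq_norm_sq, inner3]

lemma gram (a u v : E) (ha : ‖a‖ ^ 2 = 1) (hu : inner ℝ u a = 0) (hv : inner ℝ v a = 0) :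
    (inner ℝ u v) ^ 2 + (inner ℝ u (J a v)) ^ 2 = ‖u‖ ^ 2 * ‖v‖ ^ 2 := by
  have key : (inner ℝ u (J a v)) ^ 2 = ‖u‖ ^ 2 * (‖a‖ ^ 2 * ‖v‖ ^ 2 - (inner ℝ v a) ^ 2)
      - inner ℝ u a * (inner ℝ u a * ‖v‖ ^ 2 - inner ℝ v a * inner ℝ u v)
      + inner ℝ u v * (inner ℝ u a * inner ℝ v a - ‖a‖ ^ 2 * inner ℝ u v) := by
    simp only [inner3, norm3, J]
    simp
    ring
  rw [key, ha, hu, hv]; ring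

lemma J_perp (a v : E) : inner ℝ (J a v) a = 0 := by
  simp only [inner3, J]; simp; ring

lemma J_perp' (a v : E) : inner ℝ v (J a v) = 0 := by
  simp only [inner3, J]; simp; ring

lemma J_norm (a v : E) (ha : ‖a‖ ^ 2 = 1) (hv : inner ℝ v a = 0) :
    inner ℝ (J a v) (J a v) = ‖v‖ ^ 2 := by
  have : inner ℝ (J a v) (J a v) = ‖a‖ ^ 2 * ‖v‖ ^ 2 - (inner ℝ v a) ^ 2 := by
    simp only [inner3, norm3, J]
    simp
    ring
  rw [this, ha, hv]; ring

def iv (a x : E) : E := (‖x - a‖ ^ 2)⁻¹ • (x - a)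

lemma iv_norm (a x : E) : ‖iv a x‖ = ‖x - a‖⁻¹ := by
  rw [iv, norm_smul, norm_inv, norm_pow, norm_norm]
  by_cases h : ‖x - a‖ = 0
  · simp [h]
  · field_simp

lemma iv_inner (a x : E) (ha : ‖a‖ ^ 2 = 1) (hx : ‖x‖ ^ 2 = 1) (h : x ≠ a) :
    inner ℝ (iv a x) a = -1 / 2 := by
  have h0 : ‖x - a‖ ^ 2 ≠ 0 := by simpa [sub_eq_zero] using h
  have h1 : ‖x - a‖ ^ 2 = -2 * inner ℝ (x - a) a := by
    rw [norm_sub_sq_real, inner_sub_left, real_inner_self_eq_norm_sq]; linarith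
  rw [iv, real_inner_smul_left, inv_mul_eq_div, div_eq_iff h0]
  linarith

lemma iv_rec (a x : E) (h : x ≠ a) : x = a + (‖iv a x‖ ^ 2)⁻¹ • iv a x := by
  have h0 : ‖x - a‖ ≠ 0 := by simpa [sub_eq_zero] using h
  rw [iv_norm, iv, smul_smul]
  have : ((‖x - a‖⁻¹ ^ 2)⁻¹ * (‖x - a‖ ^ 2)⁻¹) = 1 := by field_simp
  rw [this]; simp

lemma iv_surj (a y : E) (ha : ‖a‖ ^ 2 = 1) (hy : inner ℝ y a = -1 / 2) :
    ∃ x : E, ‖x‖ ^ 2 = 1 ∧ x ≠ a ∧ iv a x = y := by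
  have hy0 : y ≠ 0 := by rintro rfl; norm_num at hy
  have hn : ‖y‖ ≠ 0 := by simpa using hy0
  refine ⟨a + (‖y‖ ^ 2)⁻¹ • y, ?_, ?_, ?_⟩
  · rw [norm_add_sq_real, real_inner_smul_right, real_inner_comm, hy, norm_smul, ha, norm_inv,
      norm_pow, norm_norm]
    field_simp
    ring
  · simp [hy0]
  · rw [iv, add_sub_cancel_left, norm_smul, smul_smul, norm_inv, norm_pow, norm_norm]
    have : ((((‖y‖ ^ 2)⁻¹ * ‖y‖) ^ 2)⁻¹ * (‖y‖ ^ 2)⁻¹) = 1 := by field_simp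
    rw [this]; simp

def cr (a b c x : E) : ℂ :=
  ⟨inner ℝ (iv c x - iv c a) (iv c b - iv c a) / ‖iv c b - iv c a‖ ^ 2,
   inner ℝ (iv c x - iv c a) (J c (iv c b - iv c a)) / ‖iv c b - iv c a‖ ^ 2⟩

lemma sn (x : Sphere2) : ‖(x : E)‖ ^ 2 = 1 := by
  have := x.2
  simp at this
  simp [this]

lemma perp {c x y : Sphere2} (hx : x ≠ c) (hy : y ≠ c) :
    inner ℝ (iv c x - iv c y : E) (c : E) = 0 := by
  rw [inner_sub_left, iv_inner _ _ (sn c) (sn x) (fun h => hx (Subtype.ext h)),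
    iv_inner _ _ (sn c) (sn y) (fun h => hy (Subtype.ext h)), sub_self]

lemma iv_inj {c x y : Sphere2} (hx : x ≠ c) (hy : y ≠ c) (h : iv c x = iv c y) : x = y := by
  apply Subtype.ext
  rw [iv_rec c x (fun h => hx (Subtype.ext h)), h, ← iv_rec c y (fun h => hy (Subtype.ext h))]

lemma vne {a b c : Sphere2} (hab : a ≠ b) (hac : a ≠ c) (hbc : b ≠ c) :
    ‖iv c b - iv c a‖ ≠ 0 := by
  rw [Ne, norm_eq_zero, sub_eq_zero]
  exact fun h => hab (iv_inj hbc hac h).symm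

lemma cr_norm {a b c x : Sphere2} (hab : a ≠ b) (hac : a ≠ c) (hbc : b ≠ c) (hx : x ≠ c) :
    ‖cr a b c x‖ * ‖iv c b - iv c a‖ = ‖iv c x - iv c a‖ := by
  have hv := vne hab hac hbc
  have g := gram c _ _ (sn c) (perp hx hac) (perp hbc hac)
  rw [← sq_eq_sq₀ (by positivity) (by positivity), mul_pow, Complex.sq_norm, Complex.normSq_apply]
  simp only [cr]
  field_simp
  linarith

open Classical in
def Φ (a b c x : Sphere2) : OnePoint ℂ := if x = c then OnePoint.infty else ((cr a b c x : ℂ) : OnePoint ℂ)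

lemma Φ_bij {a b c : Sphere2} (hab : a ≠ b) (hac : a ≠ c) (hbc : b ≠ c) :
    Function.Bijective (Φ a b c) := by
  have hv := vne hab hac hbc
  constructor
  · intro x y h
    unfold Φ at h
    split_ifs at h with h1 h2 h2
    · rw [h1, h2]
    · exact absurd h (OnePoint.infty_ne_coe _)
    · exact absurd h (OnePoint.coe_ne_infty _)
    · rw [OnePoint.coe_eq_coe] at h
      apply iv_inj h1 h2
      have e1 := congrArg Complex.re h
      have e2 := congrArg Complex.im h
      simp only [cr] at e1 e2
      field_simp at e1 e2
      have g := gram c _ _ (sn c) (perp h1 h2) (perp hbc hac)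
      have e : (iv c x - iv c y : E) = (iv c x - iv c a) - (iv c y - iv c a) := by abel
      have z1 : inner ℝ (iv c x - iv c y : E) (iv c b - iv c a) = 0 := by
        rw [e, inner_sub_left, e1, sub_self]
      have z2 : inner ℝ (iv c x - iv c y : E) (J c (iv c b - iv c a)) = 0 := by
        rw [e, inner_sub_left, e2, sub_self]
      rw [z1, z2] at g
      have : ‖(iv c x - iv c y : E)‖ ^ 2 = 0 := by
        have : ‖iv c b - iv c a‖ ^ 2 ≠ 0 := pow_ne_zero _ hv
        apply mul_right_cancel₀ this
        linarith
      simpa [sub_eq_zero] using this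
  · intro w
    induction w using OnePoint.rec with
    | infty => exact ⟨c, by simp [Φ]⟩
    | coe w =>
      set v : E := iv c b - iv c a with hvd
      have hp : inner ℝ v (c : E) = 0 := perp hbc hac
      obtain ⟨x, hx1, hx2, hx3⟩ := iv_surj c (iv c a + (w.re • v + w.im • J c v)) (sn c) (by
        rw [inner_add_left, inner_add_left, real_inner_smul_left, real_inner_smul_left, hp, J_perp,
          iv_inner _ _ (sn c) (sn a) (fun h => hac (Subtype.ext h))]
        ring)
      have hx1' : ‖x‖ = 1 := by
        have := norm_nonneg x
        nlinarith
      refine ⟨⟨x, by simp [hx1']⟩, ?_⟩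
      have hne : (⟨x, by simp [hx1']⟩ : Sphere2) ≠ c := fun h => hx2 (congrArg Subtype.val h)
      rw [Φ, if_neg hne, OnePoint.coe_eq_coe]
      apply Complex.ext
      · simp only [cr, hx3, ← hvd, add_sub_cancel_left, inner_add_left, real_inner_smul_left]
        rw [real_inner_comm v (J c v), J_perp', real_inner_self_eq_norm_sq]
        field_simp
        simp
      · simp only [cr, hx3, ← hvd, add_sub_cancel_left, inner_add_left, real_inner_smul_left]
        rw [J_perp', J_norm _ _ (sn c) hp]
        field_simp
        simp

lemma Φ_a {a b c : Sphere2} (hac : a ≠ c) : Φ a b c a = ((0 : ℂ) : OnePoint ℂ) := by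
  rw [Φ, if_neg hac, OnePoint.coe_eq_coe]
  apply Complex.ext <;> simp [cr]

lemma Φ_b {a b c : Sphere2} (hab : a ≠ b) (hac : a ≠ c) (hbc : b ≠ c) :
    Φ a b c b = ((1 : ℂ) : OnePoint ℂ) := by
  have hv := vne hab hac hbc
  rw [Φ, if_neg hbc, OnePoint.coe_eq_coe]
  apply Complex.ext
  · simp only [cr]
    rw [real_inner_self_eq_norm_sq]
    field_simp
    simp
  · simp [cr, J_perp']

lemma Φ_c {a b c : Sphere2} : Φ a b c c = OnePoint.infty := by simp [Φ]

lemma iv_cont {X : Type*} [TopologicalSpace X] {c x : X → E} {t : X} (hc : ContinuousAt c t)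
    (hx : ContinuousAt x t) (h : x t ≠ c t) : ContinuousAt (fun s => iv (c s) (x s)) t := by
  have h0 : ‖x t - c t‖ ^ 2 ≠ 0 := by simpa [sub_eq_zero] using h
  unfold iv
  exact (((hx.sub hc).norm.pow 2).inv₀ h0).smul (hx.sub hc)

lemma J_cont {X : Type*} [TopologicalSpace X] {c x : X → E} {t : X} (hc : ContinuousAt c t)
    (hx : ContinuousAt x t) : ContinuousAt (fun s => J (c s) (x s)) t := by
  have : Continuous (fun p : E × E => J p.1 p.2) := by
    unfold J
    apply (PiLp.continuous_toLp 2 _).comp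
    apply continuous_pi
    intro i
    fin_cases i <;> simp <;> fun_prop
  exact (this.continuousAt (x := (c t, x t))).comp (f := fun s => (c s, x s)) (hc.prodMk hx)

lemma Φ_cont {X : Type*} [TopologicalSpace X] {a b c x : X → Sphere2}
    (ha : Continuous a) (hb : Continuous b) (hc : Continuous c) (hx : Continuous x)
    (hab : ∀ t, a t ≠ b t) (hac : ∀ t, a t ≠ c t) (hbc : ∀ t, b t ≠ c t) :
    Continuous (fun t => Φ (a t) (b t) (c t) (x t)) := by
  rw [continuous_iff_continuousAt]
  intro t
  have ha' : ContinuousAt (fun t => (a t : E)) t := (continuous_subtype_val.comp ha).continuousAt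
  have hb' : ContinuousAt (fun t => (b t : E)) t := (continuous_subtype_val.comp hb).continuousAt
  have hc' : ContinuousAt (fun t => (c t : E)) t := (continuous_subtype_val.comp hc).continuousAt
  have hx' : ContinuousAt (fun t => (x t : E)) t := (continuous_subtype_val.comp hx).continuousAt
  have ia := iv_cont hc' ha' (fun h => hac t (Subtype.ext h))
  have ib := iv_cont hc' hb' (fun h => hbc t (Subtype.ext h))
  have hv := vne (hab t) (hac t) (hbc t)
  by_cases h : x t = c t
  · rw [ContinuousAt]
    have e : Φ (a t) (b t) (c t) (x t) = OnePoint.infty := by rw [h, Φ_c]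
    rw [e, OnePoint.hasBasis_nhds_infty.tendsto_right_iff]
    rintro K ⟨hK1, hK2⟩
    obtain ⟨R, hR⟩ := hK2.isBounded.exists_norm_le
    have cont : ContinuousAt (fun s => ‖(x s : E) - c s‖ *
        (R * ‖iv (c s) (b s) - iv (c s) (a s)‖ + ‖iv (c s) (a s)‖)) t :=
      (hx'.sub hc').norm.mul ((continuousAt_const.mul (ib.sub ia).norm).add ia.norm)
    have ev := cont.eventually_lt (continuousAt_const (y := (1 : ℝ))) (by simp [h])
    filter_upwards [ev] with s hs
    by_cases h' : x s = c s
    · right; rw [h', Φ_c]; rfl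
    · left
      refine ⟨cr (a s) (b s) (c s) (x s), ?_, by rw [Φ, if_neg h']⟩
      intro hmem
      have h1 := hR _ hmem
      have h2 := cr_norm (hab s) (hac s) (hbc s) h'
      have h3 := norm_sub_norm_le (iv (c s) (x s)) (iv (c s) (a s))
      rw [iv_norm] at h3
      have h4 : 0 < ‖(x s : E) - c s‖ := by
        rw [norm_pos_iff, sub_ne_zero]; exact fun h => h' (Subtype.ext h)
      have h5 := mul_le_mul_of_nonneg_right h1 (norm_nonneg (iv (c s) (b s) - iv (c s) (a s)))
      have h6 : ‖(x s : E) - c s‖⁻¹ ≤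
        R * ‖iv (c s) (b s) - iv (c s) (a s)‖ + ‖iv (c s) (a s)‖ := by linarith
      have h7 := mul_le_mul_of_nonneg_left h6 h4.le
      rw [mul_inv_cancel₀ h4.ne'] at h7
      linarith
  · have ix := iv_cont hc' hx' (fun h' => h (Subtype.ext h'))
    have ev : ∀ᶠ s in 𝓝 t, x s ≠ c s := 
      (isOpen_ne_fun hx hc).mem_nhds h
    have hv2 : ‖iv (c t) (b t) - iv (c t) (a t)‖ ^ 2 ≠ 0 := pow_ne_zero _ hv
    have k1 : ContinuousAt (fun s => cr (a s) (b s) (c s) (x s)) t := by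
      have r := (ContinuousAt.inner (𝕜 := ℝ) (ix.sub ia) (ib.sub ia)).div ((ib.sub ia).norm.pow 2) hv2
      have i := (ContinuousAt.inner (𝕜 := ℝ) (ix.sub ia) (J_cont hc' (ib.sub ia))).div ((ib.sub ia).norm.pow 2) hv2
      exact (Complex.equivRealProdCLM.symm.continuous.continuousAt).comp (r.prodMk i)
    have k2 : ContinuousAt (fun s => ((cr (a s) (b s) (c s) (x s) : ℂ) : OnePoint ℂ)) t :=
      OnePoint.continuous_coe.continuousAt.comp k1
    apply k2.congr
    filter_upwards [ev] with s hs
    rw [Φ, if_neg hs]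

end CR

end

/-- Given an identity isotopy `I = (F_t)_{t∈[0,1]}` on `S²` and three
pairwise distinct fixed points `z₁, z₂, z₃` of the time-one map `F₁`, there is an
identity isotopy `I' = (F'_t)` on `S²` with `F'₀ = Id`, `F'₁ = F₁`, fixing `z₁, z₂, z₃`
for all times `t ∈ [0,1]`. -/
theorem stmt_0 (F : ℝ → Sphere2 → Sphere2)
    (hcont : ContinuousOn (fun p : ℝ × Sphere2 => F p.1 p.2) (Set.Icc 0 1 ×ˢ Set.univ))
    (hhomeo : ∀ t ∈ Set.Icc (0 : ℝ) 1, IsHomeomorph (F t))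
    (hF0 : F 0 = id)
    (z₁ z₂ z₃ : Sphere2) (h12 : z₁ ≠ z₂) (h13 : z₁ ≠ z₃) (h23 : z₂ ≠ z₃)
    (hz₁ : F 1 z₁ = z₁) (hz₂ : F 1 z₂ = z₂) (hz₃ : F 1 z₃ = z₃) :
    ∃ F' : ℝ → Sphere2 → Sphere2,
      ContinuousOn (fun p : ℝ × Sphere2 => F' p.1 p.2) (Set.Icc 0 1 ×ˢ Set.univ) ∧
      (∀ t ∈ Set.Icc (0 : ℝ) 1, IsHomeomorph (F' t)) ∧
      F' 0 = id ∧ F' 1 = F 1 ∧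
      ∀ t ∈ Set.Icc (0 : ℝ) 1, F' t z₁ = z₁ ∧ F' t z₂ = z₂ ∧ F' t z₃ = z₃ := by
  have hinj : ∀ t ∈ Set.Icc (0 : ℝ) 1, ∀ x y, x ≠ y → F t x ≠ F t y :=
    fun t ht x y h => (hhomeo t ht).injective.ne h
  let e := Equiv.ofBijective _ (CR.Φ_bij h12 h13 h23)
  have ec : Continuous e :=
    CR.Φ_cont continuous_const continuous_const continuous_const continuous_id
      (fun _ => h12) (fun _ => h13) (fun _ => h23)
  let ψ : Sphere2 ≃ₜ OnePoint ℂ := ec.homeoOfEquivCompactToT2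
  have hψ : ∀ x, ψ x = CR.Φ z₁ z₂ z₃ x := fun x => rfl
  let G : ℝ → Sphere2 → Sphere2 := fun t x =>
    ψ.symm (CR.Φ (F t z₁) (F t z₂) (F t z₃) (F t x))
  have hG : ContinuousOn (fun p : ℝ × Sphere2 => G p.1 p.2) (Set.Icc 0 1 ×ˢ Set.univ) := by
    rw [continuousOn_iff_continuous_domRestrict]
    have hF : ∀ g : (Set.Icc (0 : ℝ) 1 ×ˢ (Set.univ : Set Sphere2) : Set (ℝ × Sphere2)) → Sphere2,
        Continuous g → Continuous (fun p => F p.1.1 (g p)) := fun g hg =>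
      hcont.comp_continuous (f := fun p : (Set.Icc (0 : ℝ) 1 ×ˢ (Set.univ : Set Sphere2) : Set (ℝ × Sphere2)) => ((p.1.1, g p) : ℝ × Sphere2))
        (by fun_prop) (fun p => ⟨p.2.1, trivial⟩)
    apply ψ.symm.continuous.comp
    exact CR.Φ_cont (hF _ continuous_const) (hF _ continuous_const) (hF _ continuous_const)
      (hF (fun p => p.1.2) (by fun_prop))
      (fun p => hinj _ p.2.1 _ _ h12) (fun p => hinj _ p.2.1 _ _ h13)
      (fun p => hinj _ p.2.1 _ _ h23)
  refine ⟨G, hG, ?_, ?_, ?_, ?_⟩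
  · intro t ht
    rw [isHomeomorph_iff_continuous_bijective]
    constructor
    · exact hG.comp_continuous (f := fun x => ((t, x) : ℝ × Sphere2)) (by fun_prop)
        (fun x => ⟨ht, trivial⟩)
    · exact ψ.symm.bijective.comp ((CR.Φ_bij (hinj t ht _ _ h12) (hinj t ht _ _ h13)
        (hinj t ht _ _ h23)).comp (hhomeo t ht).bijective)
  · funext x
    simp only [G, hF0, id]
    rw [← hψ, ψ.symm_apply_apply]
  · funext x
    simp only [G, hz₁, hz₂, hz₃]
    rw [← hψ, ψ.symm_apply_apply]
  · intro t ht
    have k12 := hinj t ht _ _ h12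
    have k13 := hinj t ht _ _ h13
    have k23 := hinj t ht _ _ h23
    refine ⟨?_, ?_, ?_⟩
    · simp only [G]
      rw [ψ.symm_apply_eq, hψ, CR.Φ_a k13, CR.Φ_a h13]
    · simp only [G]
      rw [ψ.symm_apply_eq, hψ, CR.Φ_b k12 k13 k23, CR.Φ_b h12 h13 h23]
    · simp only [G]
      rw [ψ.symm_apply_eq, hψ, CR.Φ_c, CR.Φ_c]
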